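/- arXiv:math/0309403 — 3 statements merged into one kernel-verified Lean document; each statement's English description precedes it below -/
import Mathlib

section
/- For the quantum-plane pair X = diag(1, q, ..., q^{n−1}), Y the cyclic shift (q primitive n-th root of unity), the matrix X^{n−1} Y^{n−1} does not lie in the span of all products of X and Y of length at most 2n−3. Consequently c({X,Y}) = 2n−2. -/
/-- `Lspan K n t X i` is the linear span of all products of at most `i` matrices from
the family `X` (the empty product being the identity). -/
noncomputable def Lspan (K : Type*) [Field K] (n t : ℕ)
    (X : Fin t → Matrix (Fin n) (Fin n) K) (i : ℕ) :
    Submodule K (Matrix (Fin n) (Fin n) K) :=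
  Submodule.span K {M | ∃ w : List (Fin t), w.length ≤ i ∧ M = (w.map X).prod}

/-- `Lstar K n t X` is the linear span of all products of matrices from `X`. -/
noncomputable def Lstar (K : Type*) [Field K] (n t : ℕ)
    (X : Fin t → Matrix (Fin n) (Fin n) K) :
    Submodule K (Matrix (Fin n) (Fin n) K) :=
  Submodule.span K {M | ∃ w : List (Fin t), M = (w.map X).prod}

/-- `rDim K n t X i = dim L_i`. -/
noncomputable def rDim (K : Type*) [Field K] (n t : ℕ)
    (X : Fin t → Matrix (Fin n) (Fin n) K) (i : ℕ) : ℕ :=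
  Module.finrank K (Lspan K n t X i)

/-- `rStar K n t X = dim L_*`. -/
noncomputable def rStar (K : Type*) [Field K] (n t : ℕ)
    (X : Fin t → Matrix (Fin n) (Fin n) K) : ℕ :=
  Module.finrank K (Lstar K n t X)

/-- `cSigma K n t X = min {i : r_i = r_*}`. -/
noncomputable def cSigma (K : Type*) [Field K] (n t : ℕ)
    (X : Fin t → Matrix (Fin n) (Fin n) K) : ℕ :=
  sInf {i | rDim K n t X i = rStar K n t X}

open Matrix in
theorem qp_Ypow (n : ℕ) (hn : 2 ≤ n) (Y : Matrix (Fin n) (Fin n) ℂ)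
    (hY : Y = fun i j : Fin n => if (i : ℕ) = ((j : ℕ) + 1) % n then 1 else 0) (k : ℕ)
    (i j : Fin n) : (Y ^ k) i j = if (i : ℕ) = ((j : ℕ) + k) % n then 1 else 0 := by
  induction k generalizing i j with
  | zero =>
    simp only [pow_zero, Matrix.one_apply, add_zero, Nat.mod_eq_of_lt j.2, Fin.ext_iff]
  | succ k ih =>
    rw [pow_succ, Matrix.mul_apply,
      Finset.sum_eq_single (⟨((j : ℕ) + 1) % n, Nat.mod_lt _ (by omega)⟩ : Fin n)]
    · rw [ih]
      simp only [hY, if_true, mul_one, Nat.mod_add_mod]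
      rw [show (j : ℕ) + 1 + k = j + (k + 1) by ring]
    · intro b _ hb
      have : ¬ ((b : ℕ) = ((j : ℕ) + 1) % n) := fun h => hb (Fin.ext h)
      simp [hY, this]
    · simp

theorem qp_XpowY {n : ℕ} {q : ℂ} {X Y : Matrix (Fin n) (Fin n) ℂ}
    (h : X * Y = q • (Y * X)) (a : ℕ) : X ^ a * Y = q ^ a • (Y * X ^ a) := by
  induction a with
  | zero => simp
  | succ a ih =>
    rw [pow_succ, mul_assoc, h, mul_smul_comm, ← mul_assoc, ih, smul_mul_assoc, smul_smul,
      mul_assoc, ← pow_succ']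

theorem qp_XYpow {n : ℕ} {q : ℂ} {X Y : Matrix (Fin n) (Fin n) ℂ}
    (h : X * Y = q • (Y * X)) (b : ℕ) : X * Y ^ b = q ^ b • (Y ^ b * X) := by
  induction b with
  | zero => simp
  | succ b ih =>
    rw [pow_succ, ← mul_assoc, ih, smul_mul_assoc, mul_assoc, h, mul_smul_comm, smul_smul,
      mul_assoc, ← pow_succ]

theorem qp_word {n : ℕ} {q : ℂ} (hq : q ≠ 0) {X Y : Matrix (Fin n) (Fin n) ℂ}
    (h : X * Y = q • (Y * X)) (w : List (Fin 2)) :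
    ∃ (c : ℂ) (a b : ℕ), a + b = w.length ∧ (w.map ![X, Y]).prod = c • (X ^ a * Y ^ b) := by
  induction w with
  | nil => exact ⟨1, 0, 0, by simp⟩
  | cons x w ih =>
    obtain ⟨c, a, b, hab, hw⟩ := ih
    rw [List.map_cons, List.prod_cons, hw, List.length_cons]
    fin_cases x
    · refine ⟨c, a + 1, b, by omega, ?_⟩
      simp [pow_succ', mul_assoc]
    · refine ⟨c * (q ^ a)⁻¹, a, b + 1, by omega, ?_⟩
      rw [pow_succ' Y, ← mul_assoc, qp_XpowY h, smul_mul_assoc, smul_smul, mul_assoc,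
        inv_mul_cancel₀ (pow_ne_zero _ hq)]
      simp [mul_assoc]

theorem qp_trace {n : ℕ} (hn : 2 ≤ n) {q : ℂ} (hq : IsPrimitiveRoot q n)
    {X Y : Matrix (Fin n) (Fin n) ℂ}
    (h : X * Y = q • (Y * X)) (hX : X ^ n = 1) (hY : Y ^ n = 1) (a b : ℕ)
    (hab : ¬ (n ∣ a ∧ n ∣ b)) : (X ^ a * Y ^ b).trace = 0 := by
  obtain ⟨m, rfl⟩ : ∃ m, n = m + 1 := ⟨n - 1, by omega⟩
  by_cases hb : (m + 1) ∣ b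
  · have ha : q ^ a ≠ 1 := fun e => hab ⟨(hq.pow_eq_one_iff_dvd a).1 e, hb⟩
    have e1 : (X ^ a * Y ^ b).trace = q ^ a * (X ^ a * Y ^ b).trace := by
      calc (X ^ a * Y ^ b).trace = ((X ^ a * Y) * (Y ^ b * Y ^ m)).trace := by
            rw [mul_assoc, ← mul_assoc Y, ← pow_succ', pow_succ, mul_assoc, ← pow_succ', hY, mul_one]
        _ = q ^ a * ((Y * (X ^ a * Y ^ b)) * Y ^ m).trace := by
            rw [qp_XpowY h, smul_mul_assoc, Matrix.trace_smul, smul_eq_mul]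
            simp only [mul_assoc]
        _ = _ := by
            rw [Matrix.trace_mul_comm, ← mul_assoc, ← pow_succ, hY, one_mul]
    by_contra h0
    exact ha (mul_right_cancel₀ h0 (by rw [one_mul]; exact e1.symm))
  · have hb' : q ^ b ≠ 1 := fun e => hb ((hq.pow_eq_one_iff_dvd b).1 e)
    have e1 : (X ^ a * Y ^ b).trace = q ^ b * (X ^ a * Y ^ b).trace := by
      calc (X ^ a * Y ^ b).trace = (X ^ m * (X ^ a * (X * Y ^ b))).trace := by
            rw [← mul_assoc, ← mul_assoc, ← pow_add, ← pow_succ,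
              show m + a + 1 = (m + 1) + a by ring, pow_add, hX, one_mul]
        _ = q ^ b * (X ^ m * ((X ^ a * Y ^ b) * X)).trace := by
            rw [qp_XYpow h, mul_smul_comm, mul_smul_comm, Matrix.trace_smul, smul_eq_mul]
            simp only [mul_assoc]
        _ = _ := by
            rw [Matrix.trace_mul_comm, mul_assoc, ← pow_succ', hX, mul_one]
    by_contra h0
    exact hb' (mul_right_cancel₀ h0 (by rw [one_mul]; exact e1.symm))

theorem qp_mem {n : ℕ} (X Y : Matrix (Fin n) (Fin n) ℂ) (a b i : ℕ) (h : a + b ≤ i) :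
    X ^ a * Y ^ b ∈ Lspan ℂ n 2 ![X, Y] i := by
  refine Submodule.subset_span ⟨List.replicate a 0 ++ List.replicate b 1, by simpa using h, ?_⟩
  simp

theorem qp_mono {n : ℕ} (S : Fin 2 → Matrix (Fin n) (Fin n) ℂ) {i j : ℕ} (h : i ≤ j) :
    Lspan ℂ n 2 S i ≤ Lspan ℂ n 2 S j := by
  refine Submodule.span_mono ?_
  rintro M ⟨w, hw, e⟩
  exact ⟨w, hw.trans h, e⟩

theorem qp_le_star {n : ℕ} (S : Fin 2 → Matrix (Fin n) (Fin n) ℂ) (i : ℕ) :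
    Lspan ℂ n 2 S i ≤ Lstar ℂ n 2 S := by
  refine Submodule.span_mono ?_
  rintro M ⟨w, hw, e⟩
  exact ⟨w, e⟩

/-- For the quantum-plane pair `X = diag(1, q, …, q^{n-1})`, `Y` the cyclic shift
(`q = e^{2πi/n}`), the matrix `X^{n-1} Y^{n-1}` does not lie in the span of all
products of `X` and `Y` of length at most `2n - 3`; consequently `c({X, Y}) = 2n - 2`. -/
theorem stmt12 (n : ℕ) (hn : 2 ≤ n)
    (q : ℂ) (hq : q = Complex.exp (2 * Real.pi * Complex.I / n))
    (X Y : Matrix (Fin n) (Fin n) ℂ)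
    (hX : X = Matrix.diagonal (fun i : Fin n => q ^ (i : ℕ)))
    (hY : Y = fun i j : Fin n => if (i : ℕ) = ((j : ℕ) + 1) % n then 1 else 0) :
    X ^ (n - 1) * Y ^ (n - 1) ∉ Lspan ℂ n 2 ![X, Y] (2 * n - 3) ∧
    cSigma ℂ n 2 ![X, Y] = 2 * n - 2 := by
  have hprim : IsPrimitiveRoot q n := by
    rw [hq]; exact Complex.isPrimitiveRoot_exp n (by omega)
  have hq0 : q ≠ 0 := hprim.ne_zero (by omega)
  have hqn : q ^ n = 1 := hprim.pow_eq_one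
  have hYn : Y ^ n = 1 := by
    ext i j
    rw [qp_Ypow n hn Y hY, Matrix.one_apply]
    simp only [Nat.add_mod_right, Nat.mod_eq_of_lt j.2, Fin.ext_iff]
  have hXn : X ^ n = 1 := by
    rw [hX, Matrix.diagonal_pow, ← Matrix.diagonal_one]
    congr 1
    ext i
    simp [← pow_mul, mul_comm _ n, pow_mul q n, hqn]
  have hXY : X * Y = q • (Y * X) := by
    ext i j
    rw [Matrix.smul_apply, hX, Matrix.diagonal_mul, Matrix.mul_diagonal, hY]
    by_cases e : (i : ℕ) = ((j : ℕ) + 1) % n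
    · simp only [e, if_true, mul_one, one_mul, smul_eq_mul]
      rw [← pow_succ', ← pow_mod_orderOf q ((j : ℕ) + 1), ← hprim.eq_orderOf]
    · simp [e]
  have hnot : X ^ (n - 1) * Y ^ (n - 1) ∉ Lspan ℂ n 2 ![X, Y] (2 * n - 3) := by
    intro hmem
    have key : ∀ M ∈ Lspan ℂ n 2 ![X, Y] (2 * n - 3), (X * M * Y).trace = 0 := by
      intro M hM
      unfold Lspan at hM
      induction hM using Submodule.span_induction with
      | mem M hM =>
        obtain ⟨w, hw, rfl⟩ := hM
        obtain ⟨c, a, b, hab, e⟩ := qp_word hq0 hXY w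
        rw [e, mul_smul_comm, smul_mul_assoc, Matrix.trace_smul, ← mul_assoc, ← pow_succ',
          mul_assoc, ← pow_succ, qp_trace hn hprim hXY hXn hYn, smul_zero]
        rintro ⟨h1, h2⟩
        have := Nat.le_of_dvd (by omega) h1
        have := Nat.le_of_dvd (by omega) h2
        omega
      | zero => simp
      | add x y _ _ hx hy => rw [mul_add, add_mul, Matrix.trace_add, hx, hy, add_zero]
      | smul c x _ hx => rw [mul_smul_comm, smul_mul_assoc, Matrix.trace_smul, hx, smul_zero]
    have h := key _ hmem
    rw [← mul_assoc, ← pow_succ', mul_assoc, ← pow_succ, Nat.sub_add_cancel (by omega), hXn, hYn,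
      mul_one, Matrix.trace_one, Fintype.card_fin] at h
    have : n = 0 := by exact_mod_cast h
    omega
  refine ⟨hnot, ?_⟩
  have htop : Lspan ℂ n 2 ![X, Y] (2 * n - 2) = Lstar ℂ n 2 ![X, Y] := by
    refine le_antisymm (qp_le_star _ _) (Submodule.span_le.2 ?_)
    rintro M ⟨w, rfl⟩
    obtain ⟨c, a, b, hab, e⟩ := qp_word hq0 hXY w
    rw [e, pow_eq_pow_mod a hXn, pow_eq_pow_mod b hYn]
    refine Submodule.smul_mem _ _ (qp_mem X Y _ _ _ ?_)
    have := Nat.mod_lt a (show 0 < n by omega)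
    have := Nat.mod_lt b (show 0 < n by omega)
    omega
  have hmem : (2 * n - 2) ∈ {i | rDim ℂ n 2 ![X, Y] i = rStar ℂ n 2 ![X, Y]} := by
    show rDim ℂ n 2 ![X, Y] (2 * n - 2) = rStar ℂ n 2 ![X, Y]
    unfold rDim rStar
    rw [htop]
  refine le_antisymm (Nat.sInf_le hmem) (le_csInf ⟨_, hmem⟩ ?_)
  intro i hi
  by_contra hlt
  have heq := Submodule.eq_of_le_of_finrank_eq (qp_le_star ![X, Y] i) hi
  apply hnot
  apply qp_mono ![X, Y] (show i ≤ 2 * n - 3 by omega)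
  rw [heq]
  exact qp_le_star _ _ (qp_mem X Y _ _ _ le_rfl)
end

section
/- Let (r_i)_{i≥0} be the dimension sequence of a finite set Σ of n×n matrices. If for some k with 1 ≤ k ≤ n−1 we have r_k − r_{k−1} ≤ k, or for some k with n ≤ k ≤ 2n−2 we have r_k − r_{k−1} ≤ 2n−k−2, and Σ satisfies the modified PBW property, then c(Σ) ≤ 2n−2. -/
/-- The word `t-1 … t-1 t-2 … 1 0 … 0` corresponding to the ordered monomial
`X_t^{j_t} X_{t-1}^{j_{t-1}} ⋯ X_1^{j_1}` with exponents `j`. -/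
def ordWord {t : ℕ} (j : Fin t → ℕ) : List (Fin t) :=
  ((List.finRange t).reverse).flatMap (fun i => List.replicate (j i) i)

/-- The numerical (base `t+1`) value of a word, realizing the lexicographic order on
words of a fixed length. -/
def barNum {t : ℕ} (w : List (Fin t)) : ℕ :=
  w.foldl (fun acc i => acc * (t + 1) + ((i : ℕ) + 1)) 0

/-- The modified PBW property: every product `u = X_{i_1} ⋯ X_{i_l}` can be written,
modulo `L_{l-1}`, as a linear combination of ordered monomials
`X_t^{j_t} ⋯ X_1^{j_1}` with `j_1 + ⋯ + j_t = l`, whose coefficient vanishes whenever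
the ordered monomial is lexicographically smaller than `u`. -/
def ModifiedPBW {K : Type*} [Field K] {n t : ℕ}
    (X : Fin t → Matrix (Fin n) (Fin n) K) : Prop :=
  ∀ w : List (Fin t), w ≠ [] →
    ∃ c : (Fin t → ℕ) → K,
      (∀ j ∈ Finset.Nat.antidiagonalTuple t w.length,
        barNum (ordWord j) < barNum w → c j = 0) ∧
      (w.map X).prod -
          ∑ j ∈ Finset.Nat.antidiagonalTuple t w.length,
            c j • ((ordWord j).map X).prod
        ∈ Lspan K n t X (w.length - 1)

namespace S17

lemma barNum_append {t : ℕ} (u v : List (Fin t)) :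
    barNum (u ++ v) = barNum u * (t + 1) ^ v.length + barNum v := by
  induction v using List.reverseRecOn with
  | nil => simp [barNum]
  | append_singleton v a ih =>
    have e : ∀ (x : List (Fin t)), barNum (x ++ [a]) = barNum x * (t + 1) + ((a : ℕ) + 1) := by
      intro x; simp [barNum, List.foldl_append]
    rw [← List.append_assoc, e, e, ih]
    simp only [List.length_append, List.length_singleton]
    ring

lemma barNum_snoc {t : ℕ} (x : List (Fin t)) (a : Fin t) :
    barNum (x ++ [a]) = barNum x * (t + 1) + ((a : ℕ) + 1) := by
  simp [barNum, List.foldl_append]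

lemma barNum_lt {t : ℕ} (w : List (Fin t)) : barNum w < (t + 1) ^ w.length := by
  induction w using List.reverseRecOn with
  | nil => simp [barNum]
  | append_singleton v a ih =>
    rw [barNum_snoc]
    simp only [List.length_append, List.length_singleton, pow_succ]
    have := a.2
    nlinarith

lemma barNum_inj {t : ℕ} (w : List (Fin t)) : ∀ v : List (Fin t), w.length = v.length →
    barNum w = barNum v → w = v := by
  induction w using List.reverseRecOn with
  | nil => intro v h _; exact (List.eq_nil_of_length_eq_zero h.symm).symm
  | append_singleton w a ih =>
    intro v
    induction v using List.reverseRecOn with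
    | nil => intro h; simp at h
    | append_singleton v b _ =>
      intro h hb
      rw [barNum_snoc, barNum_snoc] at hb
      have ha := a.2
      have hb' := b.2
      have h1 : barNum w = barNum v := by
        rcases lt_trichotomy (barNum w) (barNum v) with h | h | h
        · nlinarith
        · exact h
        · nlinarith
      have h2 : a = b := by
        apply Fin.ext; rw [h1] at hb; omega
      rw [ih v (by simpa using h) h1, h2]

lemma ordWord_sorted {t : ℕ} (j : Fin t → ℕ) : (ordWord j).Pairwise (· ≥ ·) := by
  unfold ordWord
  rw [List.pairwise_flatMap]
  constructor
  · intro a _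
    exact List.pairwise_replicate.2 (Or.inr le_rfl)
  · rw [List.pairwise_reverse]
    refine List.Pairwise.imp ?_ (List.pairwise_lt_finRange t)
    intro a b hab x hx y hy
    rw [List.eq_of_mem_replicate hx, List.eq_of_mem_replicate hy]
    exact hab.le

lemma ordWord_length {t : ℕ} (j : Fin t → ℕ) : (ordWord j).length = ∑ i, j i := by
  unfold ordWord
  rw [List.length_flatMap]
  simp [List.sum_reverse, Fin.sum_univ_def]

section comb

lemma comb_lemma (f : ℕ → ℕ) (hf : Antitone f) (n k : ℕ) (hn : 1 < n) (hk : 1 ≤ k)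
    (hkn : k ≤ n - 1)
    (hb : ∀ p, p + (n - 1) < 2 * n - 1 → f p ≠ f (p + (n - 1))) :
    k ≤ ((Finset.range (2 * n - 1 - k)).filter (fun p => f p ≠ f (p + k))).card := by
  classical
  set S := (Finset.range (2 * n - 1 - k)).filter (fun p => f p ≠ f (p + k)) with hS
  set E := (Finset.range (2 * n - 1 - k)).filter (fun p => f p = f (p + k)) with hE
  have hcard : E.card + S.card = 2 * n - 1 - k := by
    have := Finset.card_filter_add_card_filter_not (s := Finset.range (2 * n - 1 - k))
      (fun p => f p = f (p + k))
    rw [Finset.card_range] at this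
    exact this
  rcases E.eq_empty_or_nonempty with h0 | h0
  · rw [h0, Finset.card_empty] at hcard; omega
  set p := E.min' h0
  set q := E.max' h0
  have hp : p ∈ E := E.min'_mem h0
  have hq : q ∈ E := E.max'_mem h0
  have hpq : p ≤ q := E.min'_le _ hq
  have hp' := hp
  have hq' := hq
  simp only [hE, Finset.mem_filter, Finset.mem_range] at hp' hq'
  by_cases h : f p = f q
  · have hc : f p = f (q + k) := h.trans hq'.2
    have hlen : q + k < p + (n - 1) := by
      by_contra hcon
      push Not at hcon
      refine hb p (by omega) (le_antisymm ?_ (hf (by omega)))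
      rw [hc]; exact hf hcon
    have hsub : E ⊆ Finset.Icc p q := fun x hx =>
      Finset.mem_Icc.2 ⟨E.min'_le _ hx, E.le_max' _ hx⟩
    have := Finset.card_le_card hsub
    rw [Nat.card_Icc] at this
    omega
  · have hex : ∃ e, f e < f p := ⟨q, lt_of_le_of_ne (hf hpq) (Ne.symm h)⟩
    set e := Nat.find hex with he
    have he1 : f e < f p := Nat.find_spec hex
    have he2 : ∀ m, m < e → f p ≤ f m := fun m hm => not_lt.1 (Nat.find_min hex hm)
    have heq : e ≤ q := Nat.find_min' hex (lt_of_le_of_ne (hf hpq) (Ne.symm h))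
    have hpe : p + k < e := by
      by_contra hcon
      push Not at hcon
      have := hf hcon
      omega
    have hsub : Finset.Ico (e - k) e ⊆ S := by
      intro x hx
      rw [Finset.mem_Ico] at hx
      simp only [hS, Finset.mem_filter, Finset.mem_range]
      refine ⟨by omega, ?_⟩
      have h1 := he2 x hx.2
      have h2 : f (x + k) ≤ f e := hf (by omega)
      omega
    have := Finset.card_le_card hsub
    rw [Nat.card_Ico] at this
    omega

end comb

section main

variable {K : Type*} [Field K] {n t : ℕ} (X : Fin t → Matrix (Fin n) (Fin n) K)

/-- Span of the words smaller than `w` in the relevant order. -/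
def red (w : List (Fin t)) : Submodule K (Matrix (Fin n) (Fin n) K) :=
  Submodule.span K {M | ∃ v : List (Fin t),
    (v.length < w.length ∨ (v.length = w.length ∧ barNum w < barNum v)) ∧ M = (v.map X).prod}

lemma red_factor (a w b : List (Fin t)) (h : (w.map X).prod ∈ red X w) :
    ((a ++ w ++ b).map X).prod ∈ red X (a ++ w ++ b) := by
  have key : ∀ M ∈ red X w, (a.map X).prod * M * (b.map X).prod ∈ red X (a ++ w ++ b) := by
    intro M hM
    unfold red at hM
    induction hM using Submodule.span_induction with
    | mem x hx =>
      obtain ⟨v, hv, rfl⟩ := hx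
      refine Submodule.subset_span ⟨a ++ v ++ b, ?_, by simp [mul_assoc]⟩
      rcases hv with hv | ⟨hv, hv'⟩
      · left; simp; omega
      · right
        refine ⟨by simp [hv], ?_⟩
        rw [barNum_append (a ++ w), barNum_append (a ++ v), barNum_append a v, barNum_append a w, hv]
        gcongr
    | zero => simp
    | add x y _ _ hx hy =>
      rw [mul_add, add_mul]; exact add_mem hx hy
    | smul c x _ hx =>
      rw [mul_smul_comm, smul_mul_assoc]; exact Submodule.smul_mem _ _ hx
  have := key _ h
  simpa [mul_assoc] using this

lemma Lspan_le_red (w : List (Fin t)) (hw : w ≠ []) :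
    Lspan K n t X (w.length - 1) ≤ red X w := by
  refine Submodule.span_le.2 ?_
  rintro _ ⟨v, hv, rfl⟩
  have := List.length_pos_iff.2 hw
  exact Submodule.subset_span ⟨v, Or.inl (by omega), rfl⟩

lemma sorted_of_irred (hP : ModifiedPBW X) (w : List (Fin t)) (hw : w ≠ [])
    (h : (w.map X).prod ∉ red X w) : w.Pairwise (· ≥ ·) := by
  classical
  by_contra hs
  apply h
  obtain ⟨c, hc, hm⟩ := hP w hw
  have h1 := Lspan_le_red X w hw hm
  have h2 : ∑ j ∈ Finset.Nat.antidiagonalTuple t w.length,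
      c j • ((ordWord j).map X).prod ∈ red X w := by
    refine Submodule.sum_mem _ fun j hj => ?_
    have hl : (ordWord j).length = w.length := by
      rw [ordWord_length]; exact Finset.Nat.mem_antidiagonalTuple.1 hj
    rcases lt_trichotomy (barNum (ordWord j)) (barNum w) with hlt | heq | hgt
    · rw [hc j hj hlt, zero_smul]; exact zero_mem _
    · exact absurd (barNum_inj _ _ hl heq ▸ ordWord_sorted j) hs
    · exact Submodule.smul_mem _ _ (Submodule.subset_span ⟨_, Or.inr ⟨hl, hgt⟩, rfl⟩)
  simpa using add_mem h1 h2

lemma red_replicate (i : Fin t) :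
    ((List.replicate n i).map X).prod ∈ red X (List.replicate n i) := by
  have h := Matrix.aeval_self_charpoly (X i)
  have hm := Matrix.charpoly_monic (X i)
  have hd : (X i).charpoly.natDegree = n := by
    by_cases hn : n = 0
    · subst hn; simp [Matrix.charpoly]
    · simp [Matrix.charpoly_natDegree_eq_dim]
  rw [Polynomial.aeval_eq_sum_range, hd, Finset.sum_range_succ] at h
  have hl : (X i).charpoly.coeff n = 1 := by
    have := hm.coeff_natDegree; rwa [hd] at this
  rw [hl, one_smul] at h
  have h' : ((List.replicate n i).map X).prod =
      - ∑ j ∈ Finset.range n, (X i).charpoly.coeff j • X i ^ j := by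
    rw [List.map_replicate, List.prod_replicate]
    exact eq_neg_of_add_eq_zero_right h
  rw [h']
  refine neg_mem (Submodule.sum_mem _ fun j hj => Submodule.smul_mem _ _ ?_)
  refine Submodule.subset_span ⟨List.replicate j i, Or.inl ?_, by simp⟩
  simpa using hj

lemma card_le (k : ℕ) (hk : 1 ≤ k) (T : Finset (List (Fin t)))
    (hT : ∀ w ∈ T, w.length = k ∧ (w.map X).prod ∉ red X w) :
    rDim K n t X (k - 1) + T.card ≤ rDim K n t X k := by
  classical
  have key : ∀ T : Finset (List (Fin t)),
      (∀ w ∈ T, w.length = k ∧ (w.map X).prod ∉ red X w) →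
      rDim K n t X (k - 1) + T.card ≤ Module.finrank K
        (Lspan K n t X (k - 1) ⊔ Submodule.span K ((fun w : List (Fin t) => (w.map X).prod) '' (T : Set _)) :
          Submodule K _) := by
    intro T
    induction T using Finset.induction_on_min_value (fun w : List (Fin t) => barNum w) with
    | empty => intro _; simpa [rDim] using Submodule.finrank_mono le_sup_left
    | insert a s ha hmin ih =>
      intro h
      have ih' := ih fun w hw => h w (Finset.mem_insert_of_mem hw)
      rw [Finset.card_insert_of_notMem ha]
      obtain ⟨hal, har⟩ := h a (Finset.mem_insert_self _ _)
      have ha0 : a ≠ [] := by rintro rfl; simp at hal; omega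
      have hle : (Lspan K n t X (k - 1) ⊔
          Submodule.span K ((fun w : List (Fin t) => (w.map X).prod) '' (s : Set _)) : Submodule K _) ≤
          red X a := by
        refine sup_le (hal ▸ Lspan_le_red X a ha0) (Submodule.span_le.2 ?_)
        rintro _ ⟨v, hv, rfl⟩
        have hvl := (h v (Finset.mem_insert_of_mem hv)).1
        refine Submodule.subset_span ⟨v, Or.inr ⟨hvl.trans hal.symm, ?_⟩, rfl⟩
        refine lt_of_le_of_ne (hmin v hv) fun he => ha ?_
        rw [barNum_inj a v (hal.trans hvl.symm) he]; exact hv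
      have hlt : (Lspan K n t X (k - 1) ⊔
          Submodule.span K ((fun w : List (Fin t) => (w.map X).prod) '' (s : Set _)) : Submodule K _) <
          Lspan K n t X (k - 1) ⊔
          Submodule.span K ((fun w : List (Fin t) => (w.map X).prod) '' ((insert a s : Finset _) : Set _)) := by
        refine lt_of_le_of_ne (sup_le_sup_left (Submodule.span_mono
          (Set.image_mono (by simp))) _) fun he => har (hle ?_)
        rw [he]
        exact Submodule.mem_sup_right (Submodule.subset_span ⟨a, by simp, rfl⟩)
      have := Submodule.finrank_lt_finrank_of_lt hlt
      omega
  refine (key T hT).trans (Submodule.finrank_mono (sup_le ?_ (Submodule.span_le.2 ?_)))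
  · refine Submodule.span_mono ?_
    rintro _ ⟨v, hv, rfl⟩
    exact ⟨v, by omega, rfl⟩
  · rintro _ ⟨v, hv, rfl⟩
    exact Submodule.subset_span ⟨v, (hT v hv).1.le, rfl⟩

lemma cSigma_le (N : ℕ) (hN : ∀ w : List (Fin t), w.length = N + 1 →
    (w.map X).prod ∈ red X w) : cSigma K n t X ≤ N := by
  have h1 : ∀ m (w : List (Fin t)), w.length = N + 1 → (t + 1) ^ (N + 1) - barNum w ≤ m →
      (w.map X).prod ∈ Lspan K n t X N := by
    intro m
    induction m with
    | zero =>
      intro w hw hm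
      have := barNum_lt w
      rw [hw] at this
      omega
    | succ m ih =>
      intro w hw hm
      refine (Submodule.span_le.2 ?_ : red X w ≤ _) (hN w hw)
      rintro _ ⟨v, hv | ⟨hv, hv'⟩, rfl⟩
      · exact Submodule.subset_span ⟨v, by omega, rfl⟩
      · exact ih v (hv.trans hw) (by omega)
  have h2 : ∀ w : List (Fin t), (w.map X).prod ∈ Lspan K n t X N := by
    intro w
    induction w with
    | nil => exact Submodule.subset_span ⟨[], by simp, rfl⟩
    | cons x w ih =>
      rw [List.map_cons, List.prod_cons]
      generalize (w.map X).prod = M at ih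
      unfold Lspan at ih
      induction ih using Submodule.span_induction with
      | mem y hy =>
        obtain ⟨v, hv, rfl⟩ := hy
        by_cases hl : v.length + 1 ≤ N
        · exact Submodule.subset_span ⟨x :: v, by simpa using hl, by simp⟩
        · have := h1 _ (x :: v) (by simp; omega) le_rfl
          simpa using this
      | zero => simp
      | add x y _ _ hx hy => rw [mul_add]; exact add_mem hx hy
      | smul c x _ hx => rw [mul_smul_comm]; exact Submodule.smul_mem _ _ hx
  refine Nat.sInf_le ?_
  have : Lspan K n t X N = Lstar K n t X := by
    refine le_antisymm (Submodule.span_mono ?_) (Submodule.span_le.2 ?_)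
    · rintro _ ⟨v, _, rfl⟩; exact ⟨v, rfl⟩
    · rintro _ ⟨v, rfl⟩; exact h2 v
  show rDim K n t X N = rStar K n t X
  unfold rDim rStar
  rw [this]

/-- letters of a word as a function on `ℕ`. -/
def fw (w : List (Fin t)) (i : ℕ) : ℕ := if h : i < w.length then (w[i] : ℕ) + 1 else 0

lemma fw_anti (w : List (Fin t)) (hw : w.Pairwise (· ≥ ·)) : Antitone (fw w) := by
  intro a b hab
  unfold fw
  by_cases hb : b < w.length
  · rw [dif_pos hb, dif_pos (lt_of_le_of_lt hab hb)]
    rcases hab.eq_or_lt with rfl | hlt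
    · exact le_rfl
    · have := List.pairwise_iff_getElem.1 hw a b (by omega) hb hlt
      have : (w[b] : ℕ) ≤ w[a] := this
      omega
  · rw [dif_neg hb]; exact Nat.zero_le _

/-- window of length `k` at position `p`. -/
def win (w : List (Fin t)) (k p : ℕ) : List (Fin t) := (w.drop p).take k

lemma win_irred (w : List (Fin t)) (k p : ℕ) (h : (w.map X).prod ∉ red X w) :
    ((win w k p).map X).prod ∉ red X (win w k p) := by
  intro hr
  apply h
  have := red_factor X (w.take p) (win w k p) ((w.drop p).drop k) hr
  have e : w.take p ++ win w k p ++ (w.drop p).drop k = w := by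
    rw [win, List.append_assoc, List.take_append_drop, List.take_append_drop]
  rwa [e] at this

lemma win_eq (w : List (Fin t)) (k p q : ℕ) (hp : p + k ≤ w.length) (hq : q + k ≤ w.length)
    (h : win w k p = win w k q) (j : ℕ) (hj : j < k) : fw w (p + j) = fw w (q + j) := by
  have h' : (win w k p)[j]? = (win w k q)[j]? := by rw [h]
  simp only [win, List.getElem?_take, hj, if_true, List.getElem?_drop] at h'
  rw [List.getElem?_eq_getElem (by omega), List.getElem?_eq_getElem (by omega)] at h'
  unfold fw
  rw [dif_pos (by omega), dif_pos (by omega)]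
  simp only [Option.some.injEq] at h'
  rw [h']

lemma count (hn : 1 < n) (w : List (Fin t)) (hs : w.Pairwise (· ≥ ·))
    (h : (w.map X).prod ∉ red X w) (hl : w.length = 2 * n - 1) (k : ℕ) (hk : 1 ≤ k)
    (hk2 : k ≤ 2 * n - 2) :
    rDim K n t X (k - 1) + (((Finset.range (2 * n - 1 - k)).filter
      (fun p => fw w p ≠ fw w (p + k))).card + 1) ≤ rDim K n t X k := by
  classical
  have hf := fw_anti w hs
  set S := (Finset.range (2 * n - 1 - k)).filter (fun p => fw w p ≠ fw w (p + k)) with hS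
  have hnot : 2 * n - 1 - k ∉ S := by simp [hS]
  set S' := insert (2 * n - 1 - k) S with hS'
  have hmem : ∀ p ∈ S', p + k ≤ w.length := by
    intro p hp
    simp only [hS', hS, Finset.mem_insert, Finset.mem_filter, Finset.mem_range] at hp
    omega
  have hstep : ∀ p ∈ S', ∀ q ∈ S', p < q → win w k p ≠ win w k q := by
    intro p hp q hq hpq he
    have hpS : fw w p ≠ fw w (p + k) := by
      have := hmem q hq
      simp only [hS', hS, Finset.mem_insert, Finset.mem_filter, Finset.mem_range] at hp
      rcases hp with hp | hp
      · omega
      · exact hp.2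
    have hw := win_eq w k p q (hmem p hp) (hmem q hq) he
    have hall : ∀ j, j ≤ k → fw w p = fw w (p + j) := by
      intro j
      induction j with
      | zero => intro _; rfl
      | succ j ih =>
        intro hj
        have h1 := ih (by omega)
        have h2 := hw j (by omega)
        have h3 : fw w (q + j) ≤ fw w (p + (j + 1)) := hf (by omega)
        have h4 : fw w (p + (j + 1)) ≤ fw w (p + j) := hf (by omega)
        omega
    exact hpS (hall k le_rfl)
  have hinj : Set.InjOn (win w k) (S' : Set ℕ) := by
    intro p hp q hq he
    rcases lt_trichotomy p q with hlt | heq | hgt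
    · exact absurd he (hstep p hp q hq hlt)
    · exact heq
    · exact absurd he.symm (hstep q hq p hp hgt)
  have := card_le X k hk (S'.image (win w k)) (by
    intro v hv
    obtain ⟨p, hp, rfl⟩ := Finset.mem_image.1 hv
    refine ⟨?_, win_irred X w k p h⟩
    have := hmem p hp
    simp [win]; omega)
  rwa [Finset.card_image_of_injOn hinj, hS', Finset.card_insert_of_notMem hnot] at this

lemma block (hn : 1 < n) (w : List (Fin t)) (hs : w.Pairwise (· ≥ ·))
    (h : (w.map X).prod ∉ red X w) (p : ℕ) (hp : p + (n - 1) < w.length) :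
    fw w p ≠ fw w (p + (n - 1)) := by
  intro he
  have hf := fw_anti w hs
  have hi := win_irred X w n p h
  have : win w n p = List.replicate n (w[p]'(by omega)) := by
    refine List.ext_getElem (by simp [win]; omega) ?_
    intro j h1 h2
    have hj : j < n := by simpa using h2
    simp only [win, List.getElem_take, List.getElem_drop, List.getElem_replicate]
    have h3 : fw w (p + j) ≤ fw w p := hf (by omega)
    have h4 : fw w (p + (n - 1)) ≤ fw w (p + j) := hf (by omega)
    have h5 : fw w (p + j) = fw w p := by omega
    unfold fw at h5
    rw [dif_pos (by omega), dif_pos (by omega)] at h5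
    exact Fin.ext (by omega)
  rw [this] at hi
  exact hi (red_replicate X _)

end main

end S17

/-- Proposition 2.5: if `Σ` satisfies the modified PBW property and for some
`1 ≤ k ≤ n - 1` we have `r_k - r_{k-1} ≤ k`, or for some `n ≤ k ≤ 2n - 2` we have
`r_k - r_{k-1} ≤ 2n - k - 2`, then `c(Σ) ≤ 2n - 2`. -/
theorem stmt17 {K : Type*} [Field K] (n t : ℕ) (hn : 1 < n)
    (X : Fin t → Matrix (Fin n) (Fin n) K)
    (hPBW : ModifiedPBW X)
    (hcond : (∃ k, 1 ≤ k ∧ k ≤ n - 1 ∧ rDim K n t X k ≤ rDim K n t X (k - 1) + k) ∨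
      (∃ k, n ≤ k ∧ k ≤ 2 * n - 2 ∧
        rDim K n t X k ≤ rDim K n t X (k - 1) + (2 * n - k - 2))) :
    cSigma K n t X ≤ 2 * n - 2 := by

  by_contra hcon
  have : ∃ w : List (Fin t), w.length = 2 * n - 2 + 1 ∧ (w.map X).prod ∉ S17.red X w := by
    by_contra hno
    push Not at hno
    exact hcon (S17.cSigma_le X _ hno)
  obtain ⟨w, hl, h⟩ := this
  have hl' : w.length = 2 * n - 1 := by omega
  have hw : w ≠ [] := by rintro rfl; simp at hl
  have hs := S17.sorted_of_irred X hPBW w hw h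
  have hb := S17.block X hn w hs h
  have hf := S17.fw_anti w hs
  rcases hcond with ⟨k, hk1, hk2, hk⟩ | ⟨k, hk1, hk2, hk⟩
  · have h1 := S17.count X hn w hs h hl' k hk1 (by omega)
    have h2 := S17.comb_lemma (S17.fw w) hf n k hn hk1 hk2 (fun p hp => hb p (by omega))
    omega
  · have h1 := S17.count X hn w hs h hl' k (by omega) hk2
    rw [Finset.filter_true_of_mem, Finset.card_range] at h1
    · omega
    · intro p hp he
      rw [Finset.mem_range] at hp
      have h3 : S17.fw w (p + k) ≤ S17.fw w (p + (n - 1)) := hf (by omega)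
      have h4 : S17.fw w (p + (n - 1)) ≤ S17.fw w p := hf (by omega)
      exact hb p (by omega) (by omega)
end

section
/- Let Σ = {X_1,...,X_t} be n×n matrices satisfying the modified PBW property. Then c(Σ) ≤ 2n−2, i.e., the span of all products of length at most 2n−2 (including the identity) equals the span of all products of the X_i of arbitrary length. -/
theorem barNum_append {t : ℕ} (p q : List (Fin t)) :
    barNum (p ++ q) = barNum p * (t + 1) ^ q.length + barNum q := by
  induction q using List.reverseRecOn with
  | nil => simp [barNum]
  | append_singleton q i ih =>
    rw [← List.append_assoc]
    have h : ∀ w : List (Fin t), barNum (w ++ [i]) = barNum w * (t + 1) + ((i : ℕ) + 1) := by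
      intro w; simp [barNum, List.foldl_append]
    rw [h, h, ih]
    simp only [List.length_append, List.length_singleton, pow_succ]
    ring

theorem barNum_snoc {t : ℕ} (w : List (Fin t)) (i : Fin t) :
    barNum (w ++ [i]) = barNum w * (t + 1) + ((i : ℕ) + 1) := by
  simp [barNum, List.foldl_append]

theorem barNum_lt {t : ℕ} (w : List (Fin t)) : barNum w < (t + 1) ^ w.length := by
  induction w using List.reverseRecOn with
  | nil => simp [barNum]
  | append_singleton q i ih =>
    rw [barNum_snoc]
    simp only [List.length_append, List.length_singleton, pow_succ]
    have := i.2
    nlinarith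

theorem barNum_inj {t : ℕ} (v w : List (Fin t)) (hl : v.length = w.length)
    (h : barNum v = barNum w) : v = w := by
  induction v using List.reverseRecOn generalizing w with
  | nil => exact (List.length_eq_zero_iff.mp (by simpa using hl.symm)).symm
  | append_singleton q i ih =>
    rcases List.eq_nil_or_concat' w with rfl | ⟨w, k, rfl⟩
    · simp at hl
    · rw [barNum_snoc, barNum_snoc] at h
      have hi := i.2
      have hk := k.2
      have h1 : (i : ℕ) + 1 = k + 1 := by
        have := congrArg (· % (t + 1)) h
        simp only [Nat.mul_add_mod_self_right] at this
        rwa [Nat.mod_eq_of_lt (by omega), Nat.mod_eq_of_lt (by omega)] at this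
      have h2 : barNum q = barNum w := by
        rw [h1] at h
        exact Nat.eq_of_mul_eq_mul_right (Nat.succ_pos t) (Nat.add_right_cancel h)
      have h3 := ih w (by simpa using hl) h2
      have h4 : i = k := Fin.ext (by omega)
      rw [h3, h4]

theorem barNum_ctx {t : ℕ} (p q v w : List (Fin t)) (hl : v.length = w.length)
    (h : barNum v < barNum w) : barNum (p ++ v ++ q) < barNum (p ++ w ++ q) := by
  simp only [barNum_append, hl]
  gcongr

theorem ordWord_length {t : ℕ} (j : Fin t → ℕ) : (ordWord j).length = ∑ i, j i := by
  simp [ordWord, List.length_flatMap, List.sum_reverse, Fin.sum_univ_def]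

theorem ordWord_sorted {t : ℕ} (j : Fin t → ℕ) :
    (ordWord j).Pairwise (fun a b => b ≤ a) := by
  unfold ordWord
  rw [List.pairwise_flatMap]
  refine ⟨fun a _ => by simp [List.pairwise_replicate], ?_⟩
  rw [List.pairwise_reverse]
  refine (List.pairwise_lt_finRange t).imp ?_
  intro a b hab x hx y hy
  rw [List.mem_replicate] at hx hy
  rw [hx.2, hy.2]
  exact hab.le

section
variable {K : Type*} [Field K] {n t : ℕ} (X : Fin t → Matrix (Fin n) (Fin n) K)

theorem word_mem (w : List (Fin t)) (i : ℕ) (h : w.length ≤ i) :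
    (w.map X).prod ∈ Lspan K n t X i := Submodule.subset_span ⟨w, h, rfl⟩

theorem Lspan_mono {i k : ℕ} (h : i ≤ k) : Lspan K n t X i ≤ Lspan K n t X k :=
  Submodule.span_mono (fun _ ⟨w, hw, e⟩ => ⟨w, hw.trans h, e⟩)

theorem ctx_mem (p q : List (Fin t)) (i k : ℕ) (M : Matrix (Fin n) (Fin n) K)
    (hM : M ∈ Lspan K n t X i) (hk : p.length + i + q.length ≤ k) :
    (p.map X).prod * M * (q.map X).prod ∈ Lspan K n t X k := by
  unfold Lspan at hM
  induction hM using Submodule.span_induction with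
  | mem x hx =>
    obtain ⟨w, hw, rfl⟩ := hx
    have := word_mem X (p ++ w ++ q) k (by simp; omega)
    simpa [mul_assoc] using this
  | zero => simp
  | add x y _ _ hx hy => rw [mul_add, add_mul]; exact add_mem hx hy
  | smul a x _ hx =>
    rw [mul_smul_comm, smul_mul_assoc]; exact Submodule.smul_mem _ _ hx

theorem pow_mem_low (hn : 1 < n) (x : Fin t) : X x ^ n ∈ Lspan K n t X (n - 1) := by
  have h := Matrix.aeval_self_charpoly (X x)
  have hd : (X x).charpoly.natDegree = n := by simp
  rw [Polynomial.aeval_eq_sum_range, hd, Finset.sum_range_succ] at h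
  have hc : (X x).charpoly.coeff n = 1 := by
    have := (X x).charpoly_monic.coeff_natDegree
    rwa [hd] at this
  rw [hc, one_smul] at h
  rw [← neg_eq_of_add_eq_zero_right h]
  refine neg_mem (Submodule.sum_mem _ fun i hi => Submodule.smul_mem _ _ ?_)
  have := word_mem X (List.replicate i x) (n - 1) (by simp at hi ⊢; omega)
  simpa using this

/-- Factors of a maximal irreducible word are linearly independent. -/
theorem factor_card (u : List (Fin t)) (hu : (u.map X).prod ∉ Lspan K n t X (u.length - 1))
    (hmax : ∀ w : List (Fin t), w.length = u.length → barNum u < barNum w →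
      (w.map X).prod ∈ Lspan K n t X (u.length - 1))
    (W : Finset (List (Fin t))) (hW : ∀ w ∈ W, w <:+: u) : W.card ≤ n * n := by
  classical
  by_contra hcard
  push Not at hcard
  have hdep : ¬ LinearIndependent K (fun w : W => (w.1.map X).prod) := by
    intro hli
    have := hli.fintype_card_le_finrank
    simp [Module.finrank_matrix] at this
    omega
  rw [Fintype.not_linearIndependent_iff] at hdep
  obtain ⟨g, hg, w0, hw0⟩ := hdep
  let T : Finset W := Finset.univ.filter (fun w => g w ≠ 0)
  have hT : T.Nonempty := ⟨w0, by simp [T, hw0]⟩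
  obtain ⟨m, hmT, hm⟩ := T.exists_max_image (fun w => w.1.length) hT
  let T' : Finset W := T.filter (fun w => w.1.length = m.1.length)
  obtain ⟨v, hvT, hv⟩ := T'.exists_min_image (fun w => barNum w.1) ⟨m, by simp [T', hmT]⟩
  have hvl : v.1.length = m.1.length := (Finset.mem_filter.mp hvT).2
  have hgv : g v ≠ 0 := (Finset.mem_filter.mp (Finset.mem_filter.mp hvT).1).2
  obtain ⟨p, q, hpq⟩ := hW v.1 v.2
  have hlen : u.length = p.length + v.1.length + q.length := by rw [← hpq]; simp [add_assoc]
  have key : ∀ w : W, w ≠ v →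
      (p.map X).prod * (g w • (w.1.map X).prod) * (q.map X).prod
        ∈ Lspan K n t X (u.length - 1) := by
    intro w hwv
    by_cases h0 : g w = 0
    · simp [h0]
    have hwT : w ∈ T := by simp [T, h0]
    rw [mul_smul_comm, smul_mul_assoc]
    apply Submodule.smul_mem
    have hle : w.1.length ≤ m.1.length := hm w hwT
    rcases hle.lt_or_eq with hlt | heq
    · exact ctx_mem X p q _ _ _ (word_mem X w.1 _ le_rfl) (by omega)
    · have h1 : barNum v.1 ≤ barNum w.1 := hv w (by simp [T', hwT, heq])
      have h2 : barNum v.1 ≠ barNum w.1 := fun e =>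
        hwv (Subtype.ext (barNum_inj _ _ (by omega) e).symm)
      have h3 := barNum_ctx p q v.1 w.1 (by omega) (by omega)
      rw [hpq] at h3
      have := hmax (p ++ w.1 ++ q) (by simp; omega) h3
      simpa [mul_assoc] using this
  have hsum : (p.map X).prod * (∑ w : W, g w • (w.1.map X).prod) * (q.map X).prod = 0 := by
    rw [hg]; simp
  rw [Finset.mul_sum, Finset.sum_mul, ← Finset.add_sum_erase _ _ (Finset.mem_univ v)] at hsum
  have h4 : (p.map X).prod * (g v • (v.1.map X).prod) * (q.map X).prod
      ∈ Lspan K n t X (u.length - 1) := by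
    rw [eq_neg_of_add_eq_zero_left hsum]
    exact neg_mem (Submodule.sum_mem _ fun w hw => key w (Finset.ne_of_mem_erase hw))
  rw [mul_smul_comm, smul_mul_assoc, Submodule.smul_mem_iff _ hgv] at h4
  apply hu
  have h5 : (u.map X).prod = (p.map X).prod * (v.1.map X).prod * (q.map X).prod := by
    rw [← hpq]; simp [mul_assoc]
  rw [h5]; exact h4

end

/-- Counting pairs of positions with distinct values. -/
theorem pair_count (l k : ℕ) (f : ℕ → ℕ)
    (h : ∀ a < l, ((Finset.range l).filter (fun b => f b = f a)).card + k ≤ l) :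
    l * k ≤ 2 * (((Finset.range l) ×ˢ (Finset.range l)).filter
      (fun p => p.1 < p.2 ∧ f p.1 ≠ f p.2)).card := by
  set P := ((Finset.range l) ×ˢ (Finset.range l)).filter
      (fun p => p.1 < p.2 ∧ f p.1 ≠ f p.2) with hP
  set Q := ((Finset.range l) ×ˢ (Finset.range l)).filter
      (fun p => f p.1 ≠ f p.2) with hQ
  have h1 : Q ⊆ P ∪ P.image Prod.swap := by
    rintro ⟨a, b⟩ hab
    simp only [hQ, Finset.mem_filter, Finset.mem_product, Finset.mem_range] at hab
    rw [Finset.mem_union, Finset.mem_image]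
    rcases lt_trichotomy a b with h | h | h
    · left; simp [hP, hab, h]
    · subst h; exact absurd rfl hab.2
    · right; exact ⟨(b, a), by simp [hP, hab, h, Ne.symm hab.2], rfl⟩
  have h2 : Q.card ≤ 2 * P.card := by
    have := (Finset.card_le_card h1).trans (Finset.card_union_le _ _)
    have := Finset.card_image_le (s := P) (f := Prod.swap)
    omega
  have h3 : Q.card = ∑ a ∈ Finset.range l, ((Finset.range l).filter (fun b => f a ≠ f b)).card := by
    rw [hQ, Finset.card_filter, Finset.sum_product]
    simp only [Finset.card_filter]
  have h4 : l * k ≤ Q.card := by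
    rw [h3]
    calc l * k = ∑ a ∈ Finset.range l, k := by simp
      _ ≤ _ := Finset.sum_le_sum (fun a ha => by
        have h5 := h a (Finset.mem_range.mp ha)
        have h6 := Finset.card_filter_add_card_filter_not (s := Finset.range l) (fun b => f b = f a)
        rw [Finset.card_range] at h6
        have h7 : (Finset.range l).filter (fun b => f a ≠ f b)
            = (Finset.range l).filter (fun b => ¬ f b = f a) := by
          ext b; simp [eq_comm]
        rw [h7]; omega)
  omega

theorem shift_const (l a d m : ℕ) (f : ℕ → ℕ) (hf : ∀ i k, i ≤ k → k < l → f k ≤ f i)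
    (hm : 0 < m) (hd : 0 < d) (hl : a + d + m ≤ l) (h : ∀ i < m, f (a + i) = f (a + d + i)) :
    f (a + d - 1) = f (a + d + m - 1) := by
  have step : ∀ i, a ≤ i → i + 1 < a + d + m → f i = f (i + 1) := by
    intro i h1 h2
    obtain ⟨s, hs, h3, h4⟩ : ∃ s < m, a + s ≤ i ∧ i + 1 ≤ a + d + s := by
      by_cases hc : i + 1 ≤ a + d
      · exact ⟨0, hm, by omega, by omega⟩
      · exact ⟨i + 1 - (a + d), by omega, by omega, by omega⟩
    have e := h s hs
    have := hf (a + s) i h3 (by omega)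
    have := hf i (i + 1) (by omega) (by omega)
    have := hf (i + 1) (a + d + s) h4 (by omega)
    omega
  have all : ∀ r, a + d - 1 + r < a + d + m → f (a + d - 1) = f (a + d - 1 + r) := by
    intro r
    induction r with
    | zero => simp
    | succ r ih =>
      intro hr
      rw [ih (by omega)]
      exact step _ (by omega) (by omega)
  have := all m (by omega)
  rwa [show a + d - 1 + m = a + d + m - 1 by omega] at this

/-- A sorted word without long runs has many distinct factors. -/
theorem many_factors {t : ℕ} (n : ℕ) (hn : 1 < n) (u : List (Fin t)) (hl : u.length = 2 * n - 1)
    (hs : u.Pairwise (fun a b => b ≤ a))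
    (hrun : ∀ x, ¬ (List.replicate n x <:+: u)) :
    ∃ W : Finset (List (Fin t)), (∀ w ∈ W, w <:+: u) ∧ n * n < W.card := by
  classical
  let f : ℕ → ℕ := fun i => (u.map Fin.val).getD i 0
  have fval : ∀ i (hi : i < u.length), f i = (u[i] : ℕ) := by
    intro i hi; simp [f, hi]
  have hf : ∀ i k, i ≤ k → k < 2 * n - 1 → f k ≤ f i := by
    intro i k hik hk
    rw [fval i (by omega), fval k (by omega)]
    rcases hik.lt_or_eq with h | h
    · exact List.pairwise_iff_getElem.mp hs i k (by omega) (by omega) h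
    · subst h; exact le_rfl
  let F : ℕ × ℕ → List (Fin t) := fun p => (u.take p.2).drop p.1
  have Fin_ : ∀ p, F p <:+: u := fun p =>
    (List.drop_suffix _ _).isInfix.trans (List.take_prefix _ _).isInfix
  have Flen : ∀ a b, b ≤ 2 * n - 1 → (F (a, b)).length = b - a := by
    intro a b hb; simp [F]; omega
  have Fget : ∀ a b i, a + i < b → b ≤ 2 * n - 1 →
      ((F (a, b)).map Fin.val).getD i 0 = f (a + i) := by
    intro a b i h1 h2
    have h3 : a + i < u.length := by omega
    rw [fval _ h3]
    have h4 : i < (F (a, b)).length := by rw [Flen _ _ h2]; omega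
    rw [List.getD_eq_getElem _ _ (by simpa using h4), List.getElem_map]
    simp [F]
  have hrun' : ∀ a, a + n ≤ 2 * n - 1 → f a ≠ f (a + n - 1) := by
    intro a ha e
    apply hrun (u[a]'(by omega))
    have : F (a, a + n) = List.replicate n (u[a]'(by omega)) := by
      rw [List.eq_replicate_iff]
      refine ⟨by rw [Flen _ _ ha]; omega, ?_⟩
      intro x hx
      obtain ⟨i, hi, rfl⟩ := List.getElem_of_mem hx
      have hi' := hi
      rw [Flen _ _ ha] at hi'
      have h5 := hf a (a + i) (by omega) (by omega)
      have h6 := hf (a + i) (a + n - 1) (by omega) (by omega)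
      have h7 : f (a + i) = f a := by omega
      rw [fval _ (by omega), fval _ (by omega)] at h7
      apply Fin.ext
      rw [← h7]
      simp [F]
    rw [← this]; exact Fin_ _
  have hcnt : ∀ a < 2 * n - 1,
      ((Finset.range (2 * n - 1)).filter (fun b => f b = f a)).card + n ≤ 2 * n - 1 := by
    intro a ha
    set B := (Finset.range (2 * n - 1)).filter (fun b => f b = f a) with hB
    have hne : B.Nonempty := ⟨a, by simp [hB, ha]⟩
    have h1 := B.min'_mem hne
    have h2 := B.max'_mem hne
    set x := B.min' hne with hx
    set y := B.max' hne with hy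
    simp only [hB, Finset.mem_filter, Finset.mem_range] at h1 h2
    have hsub : B ⊆ Finset.Icc x y := fun b hb =>
      Finset.mem_Icc.mpr ⟨B.min'_le b hb, B.le_max' b hb⟩
    have h3 := Finset.card_le_card hsub
    rw [Nat.card_Icc] at h3
    have h4 : y < x + n - 1 := by
      by_contra hc
      have h5 := hf x (x + n - 1) (by omega) (by omega)
      have h6 := hf (x + n - 1) y (by omega) (by omega)
      exact hrun' x (by omega) (by omega)
    omega
  have hP := pair_count (2 * n - 1) n f hcnt
  set P := ((Finset.range (2 * n - 1)) ×ˢ (Finset.range (2 * n - 1))).filter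
      (fun p => p.1 < p.2 ∧ f p.1 ≠ f p.2) with hPdef
  let S1 : Finset (ℕ × ℕ) := (Finset.range (2 * n)).image (fun b => (0, b))
  let S2 : Finset (ℕ × ℕ) := P.image (fun p => (p.1 + 1, p.2 + 1))
  have c1 : S1.card = 2 * n := by
    rw [Finset.card_image_of_injective _ (fun a b h => by simpa using h), Finset.card_range]
  have c2 : S2.card = P.card := by
    apply Finset.card_image_of_injective
    rintro ⟨a, b⟩ ⟨c, d⟩ h
    simpa using h
  have hdis : Disjoint S1 S2 := by
    rw [Finset.disjoint_left]
    rintro ⟨a, b⟩ h1 h2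
    simp only [S1, S2, Finset.mem_image, Prod.mk.injEq] at h1 h2
    obtain ⟨_, _, h, _⟩ := h1
    obtain ⟨_, _, h', _⟩ := h2
    omega
  have hmem : ∀ a b, (a, b) ∈ S1 ∪ S2 → a ≤ b ∧ b ≤ 2 * n - 1 ∧
      (a = 0 ∨ (a < b ∧ f (a - 1) ≠ f (b - 1))) := by
    intro a b h
    rw [Finset.mem_union] at h
    rcases h with h | h
    · simp only [S1, Finset.mem_image, Finset.mem_range, Prod.mk.injEq] at h
      obtain ⟨c, h1, h2, h3⟩ := h
      omega
    · simp only [S2, hPdef, Finset.mem_image, Finset.mem_filter, Finset.mem_product,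
        Finset.mem_range, Prod.mk.injEq, Prod.exists] at h
      obtain ⟨c, d, ⟨⟨h1, h2⟩, h3, h4⟩, rfl, rfl⟩ := h
      refine ⟨by omega, by omega, Or.inr ⟨by omega, by simpa using h4⟩⟩
  have main : ∀ a b a' b', (a, b) ∈ S1 ∪ S2 → (a', b') ∈ S1 ∪ S2 →
      F (a, b) = F (a', b') → a < a' → False := by
    intro a b a' b' h h' e hlt
    obtain ⟨h1, h2, h3⟩ := hmem a b h
    obtain ⟨h1', h2', h3'⟩ := hmem a' b' h'
    have hlen := congrArg List.length e
    rw [Flen _ _ h2, Flen _ _ h2'] at hlen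
    rcases h3' with h3' | ⟨h3', h4'⟩
    · omega
    apply h4'
    have := shift_const (2 * n - 1) a (a' - a) (b - a) f hf (by omega) (by omega) (by omega) (by
      intro i hi
      rw [← Fget a b i (by omega) h2, e, Fget a' b' i (by omega) h2']
      congr 1; omega)
    rwa [show a + (a' - a) - 1 = a' - 1 by omega,
      show a + (a' - a) + (b - a) - 1 = b' - 1 by omega] at this
  have hinj : Set.InjOn F (S1 ∪ S2 : Finset (ℕ × ℕ)) := by
    rintro ⟨a, b⟩ h ⟨a', b'⟩ h' e
    rw [Finset.mem_coe] at h h'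
    rcases lt_trichotomy a a' with hlt | heq | hlt
    · exact (main a b a' b' h h' e hlt).elim
    · obtain ⟨h1, h2, h3⟩ := hmem a b h
      obtain ⟨h1', h2', h3'⟩ := hmem a' b' h'
      have hlen := congrArg List.length e
      rw [Flen _ _ h2, Flen _ _ h2'] at hlen
      rw [Prod.mk.injEq]; omega
    · exact (main a' b' a b h' h e.symm hlt).elim
  refine ⟨(S1 ∪ S2).image F, ?_, ?_⟩
  · intro w hw
    obtain ⟨p, _, rfl⟩ := Finset.mem_image.mp hw
    exact Fin_ p
  · rw [Finset.card_image_of_injOn hinj, Finset.card_union_of_disjoint hdis, c1, c2]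
    obtain ⟨k, rfl⟩ : ∃ k, n = k + 1 := ⟨n - 1, by omega⟩
    rw [show 2 * (k + 1) - 1 = 2 * k + 1 by omega] at hP
    nlinarith

theorem step_lemma {K : Type*} [Field K] {n t : ℕ} (hn : 1 < n)
    (X : Fin t → Matrix (Fin n) (Fin n) K) (hPBW : ModifiedPBW X)
    (w : List (Fin t)) (hw : w.length = 2 * n - 1) :
    (w.map X).prod ∈ Lspan K n t X (2 * n - 2) := by
  classical
  by_contra hbad
  let A : Set ℕ := {k | ∃ v : List (Fin t), v.length = 2 * n - 1 ∧ barNum v = k ∧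
    (v.map X).prod ∉ Lspan K n t X (2 * n - 2)}
  have hA : A.Nonempty := ⟨_, w, hw, rfl, hbad⟩
  have hfin : A.Finite := (Set.finite_lt_nat ((t + 1) ^ (2 * n - 1))).subset (by
    rintro k ⟨v, hv, rfl, _⟩
    have := barNum_lt v
    rwa [hv] at this)
  obtain ⟨k, ⟨u, hul, rfl, hu⟩, hmax'⟩ := Set.exists_max_image A id hfin hA
  have hl1 : u.length - 1 = 2 * n - 2 := by omega
  have hmax : ∀ w : List (Fin t), w.length = u.length → barNum u < barNum w →
      (w.map X).prod ∈ Lspan K n t X (u.length - 1) := by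
    intro v hv hlt
    by_contra hc
    rw [hl1] at hc
    have := hmax' (barNum v) ⟨v, by omega, rfl, hc⟩
    simp only [id] at this
    omega
  rw [← hl1] at hu
  have hord : ∃ j, ordWord j = u := by
    by_contra hno
    push Not at hno
    obtain ⟨c, hc0, hc⟩ := hPBW u (by rintro rfl; simp at hul; omega)
    apply hu
    rw [← sub_add_cancel (u.map X).prod (∑ j ∈ Finset.Nat.antidiagonalTuple t u.length,
            c j • ((ordWord j).map X).prod)]
    refine add_mem hc (Submodule.sum_mem _ fun j hj => ?_)
    have hjl : (ordWord j).length = u.length := by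
      rw [ordWord_length]; exact Finset.Nat.mem_antidiagonalTuple.mp hj
    rcases lt_trichotomy (barNum (ordWord j)) (barNum u) with h | h | h
    · rw [hc0 j hj h]; simp
    · exact (hno j (barNum_inj _ _ hjl h)).elim
    · exact Submodule.smul_mem _ _ (hmax _ hjl h)
  obtain ⟨j, rfl⟩ := hord
  have hrun : ∀ x, ¬ (List.replicate n x <:+: ordWord j) := by
    rintro x ⟨p, q, hpq⟩
    apply hu
    have hlen : (ordWord j).length = p.length + n + q.length := by rw [← hpq]; simp [add_assoc]
    have := ctx_mem X p q (n - 1) ((ordWord j).length - 1) _ (pow_mem_low X hn x) (by omega)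
    rw [hlen] at this ⊢
    rw [← hpq]
    simpa [mul_assoc] using this
  obtain ⟨W, hW, hcard⟩ := many_factors n hn (ordWord j) hul (ordWord_sorted j) hrun
  have := factor_card X (ordWord j) hu hmax W hW
  omega

/-- Main Theorem 2.6: if `Σ = {X_1, …, X_t}` satisfies the modified PBW property, then
`c(Σ) ≤ 2n - 2`; equivalently, the span of all products of length at most `2n - 2`
equals the span of all products of arbitrary length. -/
theorem stmt18 {K : Type*} [Field K] (n t : ℕ) (hn : 1 < n)
    (X : Fin t → Matrix (Fin n) (Fin n) K)
    (hPBW : ModifiedPBW X) :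
    cSigma K n t X ≤ 2 * n - 2 ∧ Lspan K n t X (2 * n - 2) = Lstar K n t X := by
  have hall : ∀ l, ∀ w : List (Fin t), w.length = l →
      (w.map X).prod ∈ Lspan K n t X (2 * n - 2) := by
    intro l
    induction l using Nat.strong_induction_on with
    | _ l ih =>
      intro w hw
      by_cases hle : l ≤ 2 * n - 2
      · exact word_mem X w _ (by omega)
      have hq := step_lemma hn X hPBW (w.take (2 * n - 1)) (by simp; omega)
      have h1 := ctx_mem X [] (w.drop (2 * n - 1)) (2 * n - 2) (l - 1) _ hq (by simp; omega)
      have h2 : (w.map X).prod ∈ Lspan K n t X (l - 1) := by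
        rw [List.map_nil, List.prod_nil, one_mul, ← List.prod_append, ← List.map_append,
          List.take_append_drop] at h1
        exact h1
      have h3 : Lspan K n t X (l - 1) ≤ Lspan K n t X (2 * n - 2) := by
        refine Submodule.span_le.mpr ?_
        rintro _ ⟨v, hv, rfl⟩
        exact ih v.length (by omega) v rfl
      exact h3 h2
  have heq : Lspan K n t X (2 * n - 2) = Lstar K n t X := by
    apply le_antisymm
    · exact Submodule.span_mono (fun _ ⟨w, _, e⟩ => ⟨w, e⟩)
    · refine Submodule.span_le.mpr ?_
      rintro _ ⟨w, rfl⟩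
      exact hall _ w rfl
  refine ⟨Nat.sInf_le ?_, heq⟩
  change rDim K n t X (2 * n - 2) = rStar K n t X
  rw [rDim, rStar, heq]
end
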